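/- Let a be a polynomial all of whose zeros lie on the unit circle. Then M(\bar{a}) ∩ H^∞ is an algebra: it is closed under multiplication. -/

import Mathlib

open Complex Set

noncomputable section

/-- The open unit disk in `ℂ`. -/
def unitDisk : Set ℂ := Metric.ball 0 1

/-- The `n`-th Taylor coefficient of `f` at `0`. -/
def coef (f : ℂ → ℂ) (n : ℕ) : ℂ := iteratedDeriv n f 0 / (n.factorial : ℂ)

/-- `f` belongs to the Hardy space `H²` of the unit disk. -/
def MemH2 (f : ℂ → ℂ) : Prop :=
  DifferentiableOn ℂ f unitDisk ∧ Summable fun n => ‖coef f n‖ ^ 2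

/-- The `H²` norm. -/
def norm2 (f : ℂ → ℂ) : ℝ := Real.sqrt (∑' n, ‖coef f n‖ ^ 2)

/-- The `H²` inner product. -/
def inner2 (f g : ℂ → ℂ) : ℂ := ∑' n, coef f n * (starRingEnd ℂ) (coef g n)

/-- `f` belongs to `H^∞`: bounded and analytic on the unit disk. -/
def MemHinf (f : ℂ → ℂ) : Prop :=
  DifferentiableOn ℂ f unitDisk ∧ ∃ C, ∀ z ∈ unitDisk, ‖f z‖ ≤ C

/-- The `H^∞` (sup) norm. -/
def normInf (f : ℂ → ℂ) : ℝ := sSup ((fun z => ‖f z‖) '' unitDisk)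

/-- The co-analytic Toeplitz operator `T_{\bar a}` in terms of Taylor
coefficients: the `n`-th coefficient of `T_{\bar a} f` is
`∑ₖ conj (â k) * f̂ (n + k)`. -/
def Tbar (a f : ℂ → ℂ) : ℂ → ℂ :=
  fun z => ∑' n : ℕ, (∑' k : ℕ, (starRingEnd ℂ) (coef a k) * coef f (n + k)) * z ^ n

/-- Membership in the range space `M(ā) = T_{\bar a} H²` (as functions on the disk). -/
def MemMbar (a g : ℂ → ℂ) : Prop :=
  ∃ f, MemH2 f ∧ Set.EqOn g (Tbar a f) unitDisk

/-- The range norm on `M(ā)`: `‖T_{\bar a} f‖_{ā} = ‖f‖_{H²}`. -/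
def normMbar (a g : ℂ → ℂ) : ℝ :=
  sInf {r | ∃ f, MemH2 f ∧ Set.EqOn g (Tbar a f) unitDisk ∧ r = norm2 f}

/-- `a` is outer: the analytic Toeplitz operator `T_a` (multiplication by `a`)
has dense range in `H²`. -/
def Outer (a : ℂ → ℂ) : Prop :=
  ∀ g, MemH2 g → ∀ ε > 0, ∃ f, MemH2 f ∧ norm2 (fun z => g z - a z * f z) < ε

/-- `u` is inner: multiplication by `u` is isometric on `H²`. -/
def IsInner (u : ℂ → ℂ) : Prop :=
  MemHinf u ∧ ∀ f, MemH2 f → norm2 (fun z => u z * f z) = norm2 f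

/-- `p` is (given by) a polynomial of degree `< N`, i.e. of degree at most `N - 1`. -/
def MemPoly (N : ℕ) (p : ℂ → ℂ) : Prop :=
  ∃ q : Polynomial ℂ, q.degree < (N : WithBot ℕ) ∧ ∀ z, p z = q.eval z

/-- `φ` is a multiplier from `M(ā₁)` to `M(ā₂)`. -/
def Mult (a₁ a₂ φ : ℂ → ℂ) : Prop :=
  DifferentiableOn ℂ φ unitDisk ∧
    ∀ f, MemMbar a₁ f → MemMbar a₂ fun z => φ z * f z

/-- The backward shift `B f = (f - f 0) / z`. -/
def Bshift (f : ℂ → ℂ) : ℂ → ℂ :=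
  fun z => if z = 0 then deriv f 0 else (f z - f 0) / z

open Polynomial in
/-- The polynomial with roots `ζ j`. -/
def rootPoly {N : ℕ} (ζ : Fin N → ℂ) : ℂ[X] := ∏ j, (X - C (ζ j))

lemma rootPoly_eval {N : ℕ} (ζ : Fin N → ℂ) (z : ℂ) :
    (rootPoly ζ).eval z = ∏ j, (z - ζ j) := by
  simp [rootPoly, Polynomial.eval_prod]

lemma rootPoly_monic {N : ℕ} (ζ : Fin N → ℂ) : (rootPoly ζ).Monic :=
  Polynomial.monic_prod_of_monic _ _ fun j _ => Polynomial.monic_X_sub_C (ζ j)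

lemma rootPoly_natDegree {N : ℕ} (ζ : Fin N → ℂ) : (rootPoly ζ).natDegree = N := by
  simp [rootPoly]

lemma rootPoly_isCoprime {N : ℕ} {ζ : Fin N → ℂ} (hζ : ∀ j, ζ j ≠ 0) (m : ℕ) :
    IsCoprime (rootPoly ζ) (Polynomial.X ^ m) := by
  refine IsCoprime.pow_right (IsCoprime.prod_left fun j _ => ?_)
  have := Polynomial.isCoprime_X_sub_C_of_isUnit_sub (a := ζ j) (b := 0)
    (by simpa using hζ j)
  simpa using this

/-- On the unit circle `z ^ N * conj P` is a constant multiple of `P`. -/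
lemma rootPoly_conj_reverse {N : ℕ} {ζ : Fin N → ℂ} (hζ : ∀ j, ‖ζ j‖ = 1) (z : ℂ) :
    ∑ k ∈ Finset.range (N + 1), (starRingEnd ℂ) ((rootPoly ζ).coeff k) * z ^ (N - k) =
      (∏ j, -(starRingEnd ℂ) (ζ j)) * (rootPoly ζ).eval z := by
  have hc : ∀ j, (starRingEnd ℂ) (ζ j) * ζ j = 1 := fun j => by
    rw [mul_comm, Complex.mul_conj, Complex.normSq_eq_norm_sq, hζ]; simp
  rw [rootPoly_eval, ← Finset.prod_mul_distrib]
  have hprod : ∀ j, -(starRingEnd ℂ) (ζ j) * (z - ζ j) = 1 - z * (starRingEnd ℂ) (ζ j) :=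
    fun j => by linear_combination hc j
  simp_rw [hprod]
  rcases eq_or_ne z 0 with rfl | hz
  · rw [Finset.sum_range_succ, Finset.sum_eq_zero]
    · have h := rootPoly_monic ζ
      rw [Polynomial.Monic, Polynomial.leadingCoeff, rootPoly_natDegree] at h
      simp [h]
    · intro k hk
      rw [Finset.mem_range] at hk
      rw [zero_pow (by omega), mul_zero]
  · have h1 : ∑ k ∈ Finset.range (N + 1),
        (starRingEnd ℂ) ((rootPoly ζ).coeff k) * z ^ (N - k) =
        z ^ N * (starRingEnd ℂ) ((rootPoly ζ).eval ((starRingEnd ℂ) z⁻¹)) := by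
      rw [Polynomial.eval_eq_sum_range, rootPoly_natDegree, map_sum, Finset.mul_sum]
      refine Finset.sum_congr rfl fun k hk => ?_
      have hk' : k ≤ N := by rw [Finset.mem_range] at hk; omega
      rw [map_mul, map_pow, Complex.conj_conj, pow_sub₀ _ hz hk', inv_pow]
      ring
    rw [h1, rootPoly_eval, map_prod]
    have h2 : z ^ N = ∏ _j : Fin N, z := by simp
    rw [h2, ← Finset.prod_mul_distrib]
    refine Finset.prod_congr rfl fun j _ => ?_
    rw [map_sub, Complex.conj_conj]
    field_simp

lemma mem_unitDisk {z : ℂ} : z ∈ unitDisk ↔ ‖z‖ < 1 := by simp [unitDisk]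

lemma zero_mem_unitDisk : (0 : ℂ) ∈ unitDisk := by simp [unitDisk]

lemma unitDisk_mem_nhds : unitDisk ∈ nhds (0 : ℂ) := Metric.ball_mem_nhds _ one_pos

lemma hasSum_coef {f : ℂ → ℂ} (hf : DifferentiableOn ℂ f unitDisk) {z : ℂ}
    (hz : z ∈ unitDisk) : HasSum (fun n => coef f n * z ^ n) (f z) := by
  have h := Complex.hasSum_taylorSeries_on_ball hf hz
  simp only [sub_zero, smul_eq_mul] at h
  refine h.congr_fun ?_
  intro n
  rw [coef]
  ring

lemma hasFPowerSeriesAt_of_hasSum {f : ℂ → ℂ} {c : ℕ → ℂ}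
    (h : ∀ z ∈ unitDisk, HasSum (fun n => c n * z ^ n) (f z)) :
    HasFPowerSeriesAt f (FormalMultilinearSeries.ofScalars ℂ c) 0 := by
  rw [hasFPowerSeriesAt_iff]
  filter_upwards [unitDisk_mem_nhds] with z hz
  simpa [mul_comm] using h z hz

lemma coef_eq_of_hasSum {f : ℂ → ℂ} (hf : DifferentiableOn ℂ f unitDisk) {c : ℕ → ℂ}
    (h : ∀ z ∈ unitDisk, HasSum (fun n => c n * z ^ n) (f z)) (n : ℕ) : coef f n = c n := by
  have h1 := hasFPowerSeriesAt_of_hasSum h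
  have h2 := hasFPowerSeriesAt_of_hasSum (fun z hz => hasSum_coef hf hz)
  have h3 := congrArg (fun p => FormalMultilinearSeries.coeff p n)
    (h2.eq_formalMultilinearSeries h1)
  simpa using h3

lemma coef_polynomial (P : Polynomial ℂ) (n : ℕ) : coef (fun z => P.eval z) n = P.coeff n := by
  refine coef_eq_of_hasSum P.differentiable.differentiableOn (fun z _ => ?_) n
  rw [Polynomial.eval_eq_sum_range]
  refine hasSum_sum_of_ne_finset_zero fun k hk => ?_
  rw [Polynomial.coeff_eq_zero_of_natDegree_lt (by simpa using hk), zero_mul]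

lemma coef_add {f g : ℂ → ℂ} (hf : DifferentiableOn ℂ f unitDisk)
    (hg : DifferentiableOn ℂ g unitDisk) (n : ℕ) :
    coef (fun z => f z + g z) n = coef f n + coef g n := by
  refine coef_eq_of_hasSum (hf.add hg) (c := fun n => coef f n + coef g n) (fun z hz => ?_) n
  simpa [add_mul] using (hasSum_coef hf hz).add (hasSum_coef hg hz)

lemma MemH2.add {f g : ℂ → ℂ} (hf : MemH2 f) (hg : MemH2 g) : MemH2 fun z => f z + g z := by
  refine ⟨hf.1.add hg.1, ?_⟩
  refine Summable.of_nonneg_of_le (fun n => by positivity) (fun n => ?_)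
    ((hf.2.add hg.2).mul_left 2)
  rw [coef_add hf.1 hg.1]
  have h := norm_add_le (coef f n) (coef g n)
  have := norm_nonneg (coef f n + coef g n)
  nlinarith [sq_nonneg (‖coef f n‖ - ‖coef g n‖)]

lemma memH2_polynomial (P : Polynomial ℂ) : MemH2 fun z => P.eval z := by
  refine ⟨P.differentiable.differentiableOn, ?_⟩
  simp_rw [coef_polynomial]
  refine summable_of_ne_finset_zero (s := Finset.range (P.natDegree + 1)) fun k hk => ?_
  rw [Polynomial.coeff_eq_zero_of_natDegree_lt (by simpa using hk)]
  simp

lemma memHinf_polynomial (P : Polynomial ℂ) : MemHinf fun z => P.eval z := by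
  refine ⟨P.differentiable.differentiableOn, ?_⟩
  obtain ⟨K, hK⟩ := (isCompact_closedBall (0 : ℂ) 1).exists_bound_of_continuousOn
    P.continuous.continuousOn
  exact ⟨K, fun z hz => hK z (Metric.ball_subset_closedBall hz)⟩

lemma MemHinf.mul {f g : ℂ → ℂ} (hf : MemHinf f) (hg : MemHinf g) :
    MemHinf fun z => f z * g z := by
  obtain ⟨hf, A, hA⟩ := hf
  obtain ⟨hg, B, hB⟩ := hg
  refine ⟨hf.mul hg, A * B, fun z hz => ?_⟩
  rw [norm_mul]
  exact mul_le_mul (hA z hz) (hB z hz) (norm_nonneg _) ((norm_nonneg _).trans (hA z hz))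

/-- Parseval's identity for a countable orthonormal family. -/
lemma Orthonormal.hasSum_norm_sq {E : Type*} [NormedAddCommGroup E] [InnerProductSpace ℂ E]
    {e : ℕ → E} (he : Orthonormal ℂ e) {c : ℕ → ℂ} {v : E}
    (h : HasSum (fun n => c n • e n) v) : HasSum (fun n => ‖c n‖ ^ 2) (‖v‖ ^ 2) := by
  have hc : ∀ n, inner ℂ v (e n) = (starRingEnd ℂ) (c n) := fun n => by
    have h1 := h.mapL (innerSL ℂ (e n))
    have h2 : HasSum (fun m => innerSL ℂ (e n) (c m • e m)) (c n) := by
      have := hasSum_ite_eq n (c n)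
      refine this.congr_fun fun m => ?_
      rw [innerSL_apply_apply, inner_smul_right, orthonormal_iff_ite.1 he]
      by_cases hmn : m = n
      · subst hmn; simp
      · simp [hmn, Ne.symm hmn]
    have h3 : inner ℂ (e n) v = c n := h1.unique h2
    rw [← inner_conj_symm, h3]
  have h1 := h.mapL (innerSL ℂ v)
  have h2 := h1.mapL Complex.reCLM
  rw [innerSL_apply_apply, inner_self_eq_norm_sq_to_K] at h2
  have h3 : Complex.reCLM (((‖v‖ : ℝ) : ℂ) ^ 2) = ‖v‖ ^ 2 := by
    rw [Complex.reCLM_apply, ← Complex.ofReal_pow, Complex.ofReal_re]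
  refine (h3 ▸ h2).congr_fun fun n => ?_
  rw [innerSL_apply_apply, inner_smul_right, hc, Complex.mul_conj, Complex.reCLM_apply,
    Complex.ofReal_re, Complex.normSq_eq_norm_sq]

lemma mul_fourier_mem_unitDisk {r : ℝ} (hr : 0 ≤ r) (hr1 : r < 1) (x : AddCircle (1 : ℝ)) :
    (r : ℂ) * fourier 1 x ∈ unitDisk := by
  rw [mem_unitDisk, norm_mul, fourier_apply, Circle.norm_coe, Complex.norm_real,
    Real.norm_of_nonneg hr, mul_one]
  exact hr1

/-- Parseval's identity on the circle of radius `r < 1`. -/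
lemma exists_circle_hasSum {g : ℂ → ℂ} (hg : DifferentiableOn ℂ g unitDisk) {r : ℝ}
    (hr : 0 ≤ r) (hr1 : r < 1) :
    ∃ F : C(AddCircle (1 : ℝ), ℂ), (∀ x, F x = g (r * fourier 1 x)) ∧
      HasSum (fun n => ‖coef g n * (r : ℂ) ^ n‖ ^ 2)
        (‖ContinuousMap.toLp (E := ℂ) 2 AddCircle.haarAddCircle ℂ F‖ ^ 2) := by
  have hrm : (r : ℂ) ∈ unitDisk := by
    rw [mem_unitDisk, Complex.norm_real, Real.norm_of_nonneg hr]; exact hr1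
  have hs : Summable fun n : ℕ =>
      (coef g n * (r : ℂ) ^ n) • (fourier (n : ℤ) : C(AddCircle (1 : ℝ), ℂ)) := by
    refine Summable.of_norm ?_
    simp_rw [norm_smul, fourier_norm, mul_one]
    exact (hasSum_coef hg hrm).summable.norm
  refine ⟨∑' n : ℕ, (coef g n * (r : ℂ) ^ n) • (fourier (n : ℤ) : C(AddCircle (1 : ℝ), ℂ)),
    fun x => ?_, ?_⟩
  rotate_left
  · have h := hs.hasSum.mapL
      (ContinuousMap.toLp (E := ℂ) 2 (AddCircle.haarAddCircle (T := (1 : ℝ))) ℂ)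
    simp_rw [map_smul] at h
    have ho := (orthonormal_fourier (T := (1 : ℝ))).comp (fun n : ℕ => (n : ℤ))
      Nat.cast_injective
    exact ho.hasSum_norm_sq h
  · have h1 := hs.hasSum.mapL (ContinuousMap.evalCLM ℂ x)
    refine h1.unique ((hasSum_coef hg (mul_fourier_mem_unitDisk hr hr1 x)).congr_fun fun n => ?_)
    simp [fourier_apply, mul_pow, AddCircle.toCircle_nsmul]
    ring

lemma MemHinf.mul_memH2 {φ f : ℂ → ℂ} (hφ : MemHinf φ) (hf : MemH2 f) :
    MemH2 fun z => φ z * f z := by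
  obtain ⟨hφd, K, hK⟩ := hφ
  have hd : DifferentiableOn ℂ (fun z => φ z * f z) unitDisk := hφd.mul hf.1
  have hK0 : 0 ≤ K := (norm_nonneg _).trans (hK 0 zero_mem_unitDisk)
  refine ⟨hd, ?_⟩
  set d := coef fun z => φ z * f z with hd_def
  set M := K ^ 2 * ∑' n, ‖coef f n‖ ^ 2 with hM
  have key : ∀ r : ℝ, 0 ≤ r → r < 1 → ∀ n : ℕ,
      ∑ i ∈ Finset.range n, ‖d i * (r : ℂ) ^ i‖ ^ 2 ≤ M := by
    intro r hr hr1 n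
    obtain ⟨F, hF, hFs⟩ := exists_circle_hasSum hf.1 hr hr1
    obtain ⟨G, hG, hGs⟩ := exists_circle_hasSum hd hr hr1
    have hle : ‖ContinuousMap.toLp (E := ℂ) 2 AddCircle.haarAddCircle ℂ G‖ ≤
        K * ‖ContinuousMap.toLp (E := ℂ) 2 AddCircle.haarAddCircle ℂ F‖ := by
      refine MeasureTheory.Lp.norm_le_mul_norm_of_ae_le_mul ?_
      filter_upwards [ContinuousMap.coeFn_toLp (p := 2) (𝕜 := ℂ) AddCircle.haarAddCircle G,
        ContinuousMap.coeFn_toLp (p := 2) (𝕜 := ℂ) AddCircle.haarAddCircle F] with x hx hy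
      rw [hx, hy, hG, hF, norm_mul]
      exact mul_le_mul_of_nonneg_right (hK _ (mul_fourier_mem_unitDisk hr hr1 x))
        (norm_nonneg _)
    have hFle : ‖ContinuousMap.toLp (E := ℂ) 2 AddCircle.haarAddCircle ℂ F‖ ^ 2 ≤
        ∑' n, ‖coef f n‖ ^ 2 := by
      refine hasSum_le (fun i => ?_) hFs hf.2.hasSum
      rw [norm_mul, norm_pow, Complex.norm_real, Real.norm_of_nonneg hr]
      gcongr
      exact mul_le_of_le_one_right (norm_nonneg _) (pow_le_one₀ hr hr1.le)
    calc ∑ i ∈ Finset.range n, ‖d i * (r : ℂ) ^ i‖ ^ 2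
        ≤ ‖ContinuousMap.toLp (E := ℂ) 2 AddCircle.haarAddCircle ℂ G‖ ^ 2 :=
          sum_le_hasSum _ (fun i _ => by positivity) hGs
      _ ≤ (K * ‖ContinuousMap.toLp (E := ℂ) 2 AddCircle.haarAddCircle ℂ F‖) ^ 2 := by gcongr
      _ ≤ M := by rw [mul_pow, hM]; gcongr
  refine summable_of_sum_range_le (c := M) (fun n => by positivity) fun n => ?_
  have hcont : Continuous fun r : ℝ => ∑ i ∈ Finset.range n, ‖d i * (r : ℂ) ^ i‖ ^ 2 := by
    fun_prop
  have ht : Filter.Tendsto (fun r : ℝ => ∑ i ∈ Finset.range n, ‖d i * (r : ℂ) ^ i‖ ^ 2)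
      (nhdsWithin 1 (Set.Iio 1)) (nhds (∑ i ∈ Finset.range n, ‖d i‖ ^ 2)) := by
    have := hcont.tendsto 1
    simp only [Complex.ofReal_one, one_pow, mul_one] at this
    exact this.mono_left nhdsWithin_le_nhds
  refine le_of_tendsto ht ?_
  filter_upwards [Ioo_mem_nhdsLT (zero_lt_one (α := ℝ))] with r hr
  exact key r hr.1.le hr.2 n

lemma Tbar_polynomial (P : Polynomial ℂ) {N : ℕ} (hP : P.natDegree ≤ N) {f : ℂ → ℂ}
    (hf : DifferentiableOn ℂ f unitDisk) :
    ContinuousAt (Tbar (fun z => P.eval z) f) 0 ∧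
    ∃ q : Polynomial ℂ, q.degree < (N : WithBot ℕ) ∧ ∀ z ∈ unitDisk,
      z ^ N * Tbar (fun z => P.eval z) f z =
        (∑ k ∈ Finset.range (N + 1), (starRingEnd ℂ) (P.coeff k) * z ^ (N - k)) * f z +
          q.eval z := by
  set t : ℕ → ℂ := fun n =>
    ∑' k : ℕ, (starRingEnd ℂ) (coef (fun z => P.eval z) k) * coef f (n + k) with ht
  have ht' : ∀ n, t n =
      ∑ k ∈ Finset.range (N + 1), (starRingEnd ℂ) (P.coeff k) * coef f (n + k) := fun n => by
    rw [ht]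
    simp_rw [coef_polynomial]
    refine tsum_eq_sum fun k hk => ?_
    rw [Finset.mem_range, not_lt] at hk
    rw [Polynomial.coeff_eq_zero_of_natDegree_lt (by omega), map_zero, zero_mul]
  have hsum : ∀ z ∈ unitDisk, HasSum (fun n => z ^ N * (t n * z ^ n))
      (∑ k ∈ Finset.range (N + 1), (starRingEnd ℂ) (P.coeff k) * z ^ (N - k) *
        (f z - ∑ i ∈ Finset.range k, coef f i * z ^ i)) := by
    intro z hz
    have h := hasSum_sum (s := Finset.range (N + 1)) fun k _ =>
      ((hasSum_nat_add_iff' k).2 (hasSum_coef hf hz)).mul_left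
        ((starRingEnd ℂ) (P.coeff k) * z ^ (N - k))
    refine h.congr_fun fun n => ?_
    rw [ht', Finset.sum_mul, Finset.mul_sum]
    refine Finset.sum_congr rfl fun k hk => ?_
    have hk' : k ≤ N := by rw [Finset.mem_range] at hk; omega
    have : z ^ N = z ^ (N - k) * z ^ k := by rw [← pow_add, Nat.sub_add_cancel hk']
    rw [this, pow_add]
    ring
  have hT : ∀ z ∈ unitDisk, HasSum (fun n => t n * z ^ n) (Tbar (fun z => P.eval z) f z) := by
    intro z hz
    refine Summable.hasSum ?_
    rcases eq_or_ne z 0 with rfl | hz0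
    · refine summable_of_ne_finset_zero (s := {0}) fun n hn => ?_
      rw [zero_pow (by simpa using hn), mul_zero]
    · exact (summable_mul_left_iff (pow_ne_zero N hz0)).1 (hsum z hz).summable
  refine ⟨(hasFPowerSeriesAt_of_hasSum hT).continuousAt,
    -∑ k ∈ Finset.range (N + 1), ∑ i ∈ Finset.range k,
      Polynomial.monomial (N - k + i) ((starRingEnd ℂ) (P.coeff k) * coef f i), ?_,
    fun z hz => ?_⟩
  · rw [Polynomial.degree_neg, ← Polynomial.mem_degreeLT]
    refine Submodule.sum_mem _ fun k hk => Submodule.sum_mem _ fun i hi => ?_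
    rw [Polynomial.mem_degreeLT]
    refine (Polynomial.degree_monomial_le _ _).trans_lt ?_
    rw [Finset.mem_range] at hk hi
    exact_mod_cast (by omega : N - k + i < N)
  · rw [((hT z hz).mul_left (z ^ N)).unique (hsum z hz)]
    simp only [Polynomial.eval_neg, Polynomial.eval_finsetSum, Polynomial.eval_monomial,
      Finset.sum_mul]
    rw [← sub_eq_add_neg, ← Finset.sum_sub_distrib]
    refine Finset.sum_congr rfl fun k _ => ?_
    rw [mul_sub, Finset.mul_sum]
    congr 1
    refine Finset.sum_congr rfl fun i _ => ?_
    rw [pow_add]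
    ring

lemma eqOn_zero_of_pow_mul_eq_polynomial {h : ℂ → ℂ} (hc : ContinuousAt h 0) (N : ℕ) :
    ∀ r : Polynomial ℂ, r.degree < (N : WithBot ℕ) →
      (∀ z ∈ unitDisk, z ^ N * h z = r.eval z) → ∀ z ∈ unitDisk, h z = 0 := by
  have hlim : ∀ g : ℂ → ℂ, ContinuousAt g 0 → (∀ z ∈ unitDisk, z ≠ 0 → g z = 0) → g 0 = 0 := by
    intro g hg h0
    have h1 : Filter.Tendsto g (nhdsWithin 0 {0}ᶜ) (nhds (g 0)) :=
      hg.tendsto.mono_left nhdsWithin_le_nhds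
    have h2 : Filter.Tendsto g (nhdsWithin 0 {0}ᶜ) (nhds 0) := by
      refine tendsto_const_nhds.congr' ?_
      filter_upwards [mem_nhdsWithin_of_mem_nhds unitDisk_mem_nhds, self_mem_nhdsWithin]
        with z hz hz0
      exact (h0 z hz hz0).symm
    exact tendsto_nhds_unique h1 h2
  induction N with
  | zero =>
    intro r hr hz z hzm
    have : r = 0 := by
      rw [← Polynomial.degree_eq_bot]
      exact (Nat.WithBot.lt_zero_iff).1 (by simpa using hr)
    simpa [this] using hz z hzm
  | succ n ih =>
    intro r hr hz
    have hr0 : r.coeff 0 = 0 := by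
      rw [Polynomial.coeff_zero_eq_eval_zero, ← hz 0 zero_mem_unitDisk]
      simp
    have hrX : Polynomial.X * r.divX = r := by
      conv_rhs => rw [← Polynomial.X_mul_divX_add r, hr0]
      simp
    have hne : ∀ z ∈ unitDisk, z ≠ 0 → z ^ n * h z - r.divX.eval z = 0 := by
      intro z hzm hz0
      have h1 := hz z hzm
      rw [← hrX, Polynomial.eval_mul, Polynomial.eval_X, pow_succ'] at h1
      exact mul_left_cancel₀ hz0 (by linear_combination h1)
    refine ih r.divX ?_ fun z hzm => ?_
    · rcases eq_or_ne r 0 with rfl | hr1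
      · simp
      · have := Polynomial.degree_divX_lt hr1
        rw [Polynomial.degree_eq_natDegree hr1] at this hr
        have h2 : r.natDegree ≤ n := by
          have : r.natDegree < n + 1 := by exact_mod_cast hr
          omega
        exact this.trans_le (by exact_mod_cast h2)
    · rcases eq_or_ne z 0 with rfl | hz0
      · refine sub_eq_zero.1 (hlim (fun z => z ^ n * h z - r.divX.eval z) ?_ hne)
        exact ((continuousAt_id.pow n).mul hc).sub r.divX.continuous.continuousAt
      · exact sub_eq_zero.1 (hne z hzm hz0)

/-- The sum of the range of multiplication by `P` on `H²` and the polynomials. -/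
def MemMulAddPoly (P : Polynomial ℂ) (h : ℂ → ℂ) : Prop :=
  ∃ f, MemH2 f ∧ ∃ q : Polynomial ℂ, ∀ z ∈ unitDisk, h z = P.eval z * f z + q.eval z

lemma MemMulAddPoly.add {P : Polynomial ℂ} {h k : ℂ → ℂ} (hh : MemMulAddPoly P h)
    (hk : MemMulAddPoly P k) : MemMulAddPoly P fun z => h z + k z := by
  obtain ⟨f, hf, q, hq⟩ := hh
  obtain ⟨g, hg, s, hs⟩ := hk
  refine ⟨_, hf.add hg, q + s, fun z hz => ?_⟩
  rw [Polynomial.eval_add]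
  linear_combination hq z hz + hs z hz

lemma MemMulAddPoly.polynomial_mul {P : Polynomial ℂ} {h : ℂ → ℂ} (hh : MemMulAddPoly P h)
    (p : Polynomial ℂ) : MemMulAddPoly P fun z => p.eval z * h z := by
  obtain ⟨f, hf, q, hq⟩ := hh
  refine ⟨_, (memHinf_polynomial p).mul_memH2 hf, p * q, fun z hz => ?_⟩
  rw [Polynomial.eval_mul]
  linear_combination p.eval z * hq z hz

lemma MemMulAddPoly.congr {P : Polynomial ℂ} {h k : ℂ → ℂ} (hh : MemMulAddPoly P h)
    (hk : ∀ z ∈ unitDisk, k z = h z) : MemMulAddPoly P k := by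
  obtain ⟨f, hf, q, hq⟩ := hh
  exact ⟨f, hf, q, fun z hz => (hk z hz).trans (hq z hz)⟩

lemma MemH2.memMulAddPoly {f : ℂ → ℂ} (hf : MemH2 f) (P : Polynomial ℂ) :
    MemMulAddPoly P fun z => P.eval z * f z :=
  ⟨f, hf, 0, fun z _ => by simp⟩

lemma MemHinf.memH2 {φ : ℂ → ℂ} (hφ : MemHinf φ) : MemH2 φ := by
  simpa using hφ.mul_memH2 (memH2_polynomial 1)

lemma prod_neg_conj_ne_zero {N : ℕ} {ζ : Fin N → ℂ} (hζ : ∀ j, ‖ζ j‖ = 1) :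
    (∏ j, -(starRingEnd ℂ) (ζ j)) ≠ 0 := by
  refine Finset.prod_ne_zero_iff.2 fun j _ => ?_
  have : ζ j ≠ 0 := norm_ne_zero_iff.1 (by rw [hζ]; exact one_ne_zero)
  simpa using this

/-- Functions continuous at `0` in the range of the co-analytic Toeplitz operator with a
polynomial symbol of degree `N` having unimodular zeros are those whose product with `z ^ N`
lies in `P H² + ℂ[z]`. -/
lemma memMbar_iff {N : ℕ} {ζ : Fin N → ℂ} (hζ : ∀ j, ‖ζ j‖ = 1) {g : ℂ → ℂ}
    (hg : ContinuousAt g 0) :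
    MemMbar (fun z => (rootPoly ζ).eval z) g ↔
      MemMulAddPoly (rootPoly ζ) fun z => z ^ N * g z := by
  set c := ∏ j, -(starRingEnd ℂ) (ζ j)
  have hc : c ≠ 0 := prod_neg_conj_ne_zero hζ
  constructor
  · rintro ⟨f, hf, hgf⟩
    obtain ⟨-, q, -, hq⟩ := Tbar_polynomial (rootPoly ζ) (rootPoly_natDegree ζ).le hf.1
    refine ⟨_, (memHinf_polynomial (Polynomial.C c)).mul_memH2 hf, q, fun z hz => ?_⟩
    have h := hq z hz
    rw [← hgf hz, rootPoly_conj_reverse hζ] at h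
    rw [Polynomial.eval_C]
    linear_combination h
  · rintro ⟨f, hf, q, hq⟩
    have hF := (memHinf_polynomial (Polynomial.C c⁻¹)).mul_memH2
      (hf.add (memH2_polynomial (q /ₘ rootPoly ζ)))
    simp only [Polynomial.eval_C] at hF
    obtain ⟨hcont, s, hsN, hs⟩ :=
      Tbar_polynomial (rootPoly ζ) (rootPoly_natDegree ζ).le hF.1
    refine ⟨_, hF, fun z hz => sub_eq_zero.1 ?_⟩
    refine eqOn_zero_of_pow_mul_eq_polynomial (hg.sub hcont) N (q %ₘ rootPoly ζ - s) ?_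
      (fun w hw => ?_) z hz
    · have h1 := Polynomial.degree_modByMonic_lt q (rootPoly_monic ζ)
      rw [Polynomial.degree_eq_natDegree (rootPoly_monic ζ).ne_zero, rootPoly_natDegree] at h1
      exact (Polynomial.degree_sub_le _ _).trans_lt (max_lt h1 hsN)
    · have h1 := hs w hw
      have h2 := congrArg (Polynomial.eval w) (Polynomial.modByMonic_add_div q (rootPoly ζ))
      rw [rootPoly_conj_reverse hζ] at h1
      rw [Polynomial.eval_add, Polynomial.eval_mul] at h2
      have h3 : c * (rootPoly ζ).eval w * (c⁻¹ * (f w + (q /ₘ rootPoly ζ).eval w)) =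
          (rootPoly ζ).eval w * (f w + (q /ₘ rootPoly ζ).eval w) := by
        field_simp
      rw [h3] at h1
      simp only [Pi.sub_apply, Polynomial.eval_sub]
      linear_combination hq w hw - h1 - h2

/-- for a polynomial `a` with all zeros on the unit circle,
`M(ā) ∩ H^∞` is closed under multiplication. -/
theorem stmt6 (N : ℕ) (ζ : Fin N → ℂ) (hζ : ∀ j, ‖ζ j‖ = 1) (φ₁ φ₂ : ℂ → ℂ)
    (h₁ : MemMbar (fun z => ∏ j, (z - ζ j)) φ₁ ∧ MemHinf φ₁)
    (h₂ : MemMbar (fun z => ∏ j, (z - ζ j)) φ₂ ∧ MemHinf φ₂) :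
    MemMbar (fun z => ∏ j, (z - ζ j)) (fun z => φ₁ z * φ₂ z) ∧
      MemHinf fun z => φ₁ z * φ₂ z := by
  have hζ0 : ∀ j, ζ j ≠ 0 := fun j => norm_ne_zero_iff.1 (by rw [hζ]; exact one_ne_zero)
  obtain ⟨hM₁, hφ₁⟩ := h₁
  obtain ⟨hM₂, hφ₂⟩ := h₂
  have hc : ∀ {φ : ℂ → ℂ}, MemHinf φ → ContinuousAt φ 0 := fun h =>
    (h.1.differentiableAt unitDisk_mem_nhds).continuousAt
  refine ⟨?_, hφ₁.mul hφ₂⟩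
  simp_rw [← rootPoly_eval] at hM₁ hM₂ ⊢
  rw [memMbar_iff hζ (hc hφ₁)] at hM₁
  rw [memMbar_iff hζ (hc hφ₂)] at hM₂
  rw [memMbar_iff hζ (hc (hφ₁.mul hφ₂))]
  obtain ⟨u, v, huv⟩ := rootPoly_isCoprime hζ0 N
  have hX₁ : MemMulAddPoly (rootPoly ζ) φ₁ := by
    refine (((hφ₁.memH2.memMulAddPoly (rootPoly ζ)).polynomial_mul u).add
      (hM₁.polynomial_mul v)).congr fun z _ => ?_
    have h := congrArg (Polynomial.eval z) huv
    simp only [Polynomial.eval_add, Polynomial.eval_mul, Polynomial.eval_pow,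
      Polynomial.eval_X, Polynomial.eval_one] at h
    linear_combination -φ₁ z * h
  obtain ⟨f₂, hf₂, p₂, hp₂⟩ := hM₂
  refine (((hφ₁.mul_memH2 hf₂).memMulAddPoly (rootPoly ζ)).add
    (hX₁.polynomial_mul p₂)).congr fun z hz => ?_
  linear_combination φ₁ z * hp₂ z hz
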